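/- Let ψ⁺ ≥ 0 and ψ⁻ ≥ 0 be penalties, let ỹ₁, …, ỹ_m ∈ ℝ be reconciled bottom-level forecasts (pseudo-offers) and y₁, …, y_m ∈ ℝ be realizations, with ỹ_sum = ∑_{i=1}^m ỹ_i and y_sum = ∑_{i=1}^m y_i. Let w ∈ [0,1] and assume ∑_{j=1}^m c(ỹ_j, y_j) > 0. Define γ_i^pc = c(ỹ_i, y_i) / ∑_{j=1}^m c(ỹ_j, y_j). Then the allocated cost of producer i satisfies (1 − w)·c(ỹ_i, y_i) + w·γ_i^pc·c(ỹ_sum, y_sum) ≤ c(ỹ_i, y_i) for every i. -/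

import Mathlib

/-- Imbalance cost of an offer `q` against a realization `y`. -/
noncomputable def imbalanceCost (ψp ψm q y : ℝ) : ℝ :=
  ψp * max (y - q) 0 + ψm * max (q - y) 0

theorem imbalanceCost_nonneg {ψp ψm : ℝ} (hψp : 0 ≤ ψp) (hψm : 0 ≤ ψm) (q y : ℝ) :
    0 ≤ imbalanceCost ψp ψm q y := by
  unfold imbalanceCost
  positivity

/-- The imbalance cost is subadditive: aggregating offers nets out opposite deviations. -/
theorem imbalanceCost_sum_le {ι : Type*} {ψp ψm : ℝ} (hψp : 0 ≤ ψp) (hψm : 0 ≤ ψm)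
    (s : Finset ι) (q y : ι → ℝ) :
    imbalanceCost ψp ψm (∑ j ∈ s, q j) (∑ j ∈ s, y j) ≤
      ∑ j ∈ s, imbalanceCost ψp ψm (q j) (y j) := by
  have max_sum_le (f : ι → ℝ) : max (∑ j ∈ s, f j) 0 ≤ ∑ j ∈ s, max (f j) 0 :=
    max_le (Finset.sum_le_sum fun j _ => le_max_left _ _)
      (Finset.sum_nonneg fun j _ => le_max_right _ _)
  simp only [imbalanceCost, Finset.sum_add_distrib, ← Finset.mul_sum, ← Finset.sum_sub_distrib]
  gcongr <;> exact max_sum_le _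

/-- With proportional-cost shares `γ_i^pc`, the allocated cost of each producer is at most
its pseudo-offer cost. -/
theorem allocated_cost_le_pseudo_cost_pc (ψp ψm : ℝ) (hψp : 0 ≤ ψp) (hψm : 0 ≤ ψm)
    (m : ℕ) (ytil y : Fin m → ℝ) (w : ℝ) (hw0 : 0 ≤ w) (hw1 : w ≤ 1)
    (hsum : 0 < ∑ j, imbalanceCost ψp ψm (ytil j) (y j)) :
    ∀ i, (1 - w) * imbalanceCost ψp ψm (ytil i) (y i) +
        w * (imbalanceCost ψp ψm (ytil i) (y i) / ∑ j, imbalanceCost ψp ψm (ytil j) (y j)) *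
          imbalanceCost ψp ψm (∑ j, ytil j) (∑ j, y j) ≤
      imbalanceCost ψp ψm (ytil i) (y i) := by
  intro i
  set C := ∑ j, imbalanceCost ψp ψm (ytil j) (y j)
  set c := imbalanceCost ψp ψm (ytil i) (y i)
  have hc : 0 ≤ c := imbalanceCost_nonneg hψp hψm _ _
  calc (1 - w) * c + w * (c / C) * imbalanceCost ψp ψm (∑ j, ytil j) (∑ j, y j)
      ≤ (1 - w) * c + w * (c / C) * C := by
        gcongr
        exact imbalanceCost_sum_le hψp hψm _ _ _
    _ = c := by
        field_simp
        ring
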